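/- arXiv:1601.03436 — 2 statements merged into one kernel-verified Lean document; each statement's English description precedes it below -/
import Mathlib

section
/- Let R be an associative unital ring, M a left R-module that is projective in σ[M] and semiprime, and N ≤ M a submodule. Then: (1) Ann_M(N) ∩ N = 0; (2) every fully invariant submodule L of M with L ∩ N = 0 satisfies L ≤ Ann_M(N) (so Ann_M(N) is the unique fully invariant pseudocomplement of N in M); and (3) (N + Ann_M(N)) ∩ L ≠ 0 for every nonzero fully invariant submodule L of M. -/
universe u v

section Defs

variable (R : Type u) [Ring R] (M : Type v) [AddCommGroup M] [Module R M]

/-- The product `K ·_M L` of submodules: the sum of all images `f K` over `f : M → L`. -/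
def prodM (K L : Submodule R M) : Submodule R M :=
  ⨆ (f : M →ₗ[R] M) (_ : LinearMap.range f ≤ L), K.map f

/-- A submodule is fully invariant if it is stable under every endomorphism. -/
def IsFullyInvariant (N : Submodule R M) : Prop :=
  ∀ f : M →ₗ[R] M, N.map f ≤ N

/-- A fully invariant submodule `N` is prime in `M` if `K ·_M L ≤ N` implies `K ≤ N` or
`L ≤ N` for all fully invariant submodules `K, L`. -/
def IsPrimeSubmodule (N : Submodule R M) : Prop :=
  IsFullyInvariant R M N ∧
    ∀ K L : Submodule R M, IsFullyInvariant R M K → IsFullyInvariant R M L →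
      prodM R M K L ≤ N → K ≤ N ∨ L ≤ N

/-- A fully invariant submodule `N` is semiprime in `M` if `K ·_M K ≤ N` implies `K ≤ N`
for every fully invariant submodule `K`. -/
def IsSemiprimeSubmodule (N : Submodule R M) : Prop :=
  IsFullyInvariant R M N ∧
    ∀ K : Submodule R M, IsFullyInvariant R M K → prodM R M K K ≤ N → K ≤ N

/-- `M` is a semiprime module if `⊥` is semiprime in `M`. -/
def IsSemiprimeModule : Prop := IsSemiprimeSubmodule R M ⊥

/-- `M` is a prime module if `⊥` is prime in `M`. -/
def IsPrimeModule : Prop := IsPrimeSubmodule R M ⊥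

/-- A minimal prime submodule: prime and minimal among prime submodules. -/
def IsMinimalPrimeSubmodule (P : Submodule R M) : Prop :=
  IsPrimeSubmodule R M P ∧ ∀ Q : Submodule R M, IsPrimeSubmodule R M Q → Q ≤ P → Q = P

/-- `X` is `M`-generated: a homomorphic image of a direct sum of copies of `M`. -/
def IsMGenerated (X : Type v) [AddCommGroup X] [Module R X] : Prop :=
  ∃ (ι : Type v) (f : (ι →₀ M) →ₗ[R] X), Function.Surjective f

/-- `X` belongs to `σ[M]`: isomorphic to a submodule of an `M`-generated module. -/
def InSigmaM (X : Type v) [AddCommGroup X] [Module R X] : Prop :=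
  ∃ (Y : Type v) (_ : AddCommGroup Y) (_ : Module R Y),
    IsMGenerated R M Y ∧ ∃ g : X →ₗ[R] Y, Function.Injective g

/-- `M` is projective in `σ[M]`. -/
def ProjectiveInSigmaM : Prop :=
  ∀ (A B : Type v) [AddCommGroup A] [Module R A] [AddCommGroup B] [Module R B],
    InSigmaM R M A → InSigmaM R M B →
      ∀ g : A →ₗ[R] B, Function.Surjective g →
        ∀ h : M →ₗ[R] B, ∃ f : M →ₗ[R] A, g ∘ₗ f = h

/-- `N` is essential in `M`. -/
def IsEssentialSub (N : Submodule R M) : Prop :=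
  ∀ L : Submodule R M, L ≠ ⊥ → N ⊓ L ≠ ⊥

/-- `M` has finite uniform dimension: no infinite independent family of nonzero submodules. -/
def HasFinUdim : Prop :=
  ¬ ∃ f : ℕ → Submodule R M, (∀ n, f n ≠ ⊥) ∧
      ∀ n, Disjoint (f n) (⨆ (m) (_ : m ≠ n), f m)

/-- A left annihilator in `M`: an intersection `⋂_{f ∈ X} ker f` with `X ⊆ End_R(M)`. -/
def IsLeftAnnihilatorSub (N : Submodule R M) : Prop :=
  ∃ X : Set (M →ₗ[R] M), N = ⨅ f ∈ X, LinearMap.ker f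

/-- ACC on left annihilators. -/
def AccLeftAnnihilators : Prop :=
  ∀ a : ℕ → Submodule R M, (∀ n, IsLeftAnnihilatorSub R M (a n)) → Monotone a →
    ∃ n, ∀ m, n ≤ m → a m = a n

/-- `M` is a Goldie module: ACC on left annihilators and finite uniform dimension. -/
def IsGoldieModule : Prop := AccLeftAnnihilators R M ∧ HasFinUdim R M

/-- `Ann_M(K) = ⋂ { ker f | f ∈ Hom_R(M, K) }`. -/
def annM (K : Submodule R M) : Submodule R M :=
  ⨅ (f : M →ₗ[R] M) (_ : LinearMap.range f ≤ K), LinearMap.ker f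

/-- `N` is an annihilator submodule: `N = Ann_M(K)` for some nonzero submodule `K`. -/
def IsAnnihilatorSub (N : Submodule R M) : Prop :=
  ∃ K : Submodule R M, K ≠ ⊥ ∧ N = annM R M K

/-- A submodule `U` is uniform: nonzero and every nonzero submodule of `U` is essential in `U`. -/
def IsUniformSub (U : Submodule R M) : Prop :=
  U ≠ ⊥ ∧ ∀ A B : Submodule R M, A ≤ U → B ≤ U → A ≠ ⊥ → B ≠ ⊥ → A ⊓ B ≠ ⊥

/-- A submodule `U` is monoform: nonzero and every nonzero homomorphism `L → U` from a
submodule `L ≤ U` is injective. -/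
def IsMonoformSub (U : Submodule R M) : Prop :=
  U ≠ ⊥ ∧ ∀ L : Submodule R M, L ≤ U → ∀ f : L →ₗ[R] U, f ≠ 0 → Function.Injective f

/-- `M` has enough monoforms: every nonzero submodule contains a monoform submodule. -/
def HasEnoughMonoforms : Prop :=
  ∀ N : Submodule R M, N ≠ ⊥ → ∃ U : Submodule R M, U ≤ N ∧ IsMonoformSub R M U

/-- `M` is weakly compressible. -/
def WeaklyCompressible : Prop :=
  ∀ N : Submodule R M, N ≠ ⊥ → ∃ f : M →ₗ[R] M, LinearMap.range f ≤ N ∧ f ∘ₗ f ≠ 0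

/-- `M` is retractable: `Hom_R(M, N) ≠ 0` for every nonzero submodule `N`. -/
def Retractable : Prop :=
  ∀ N : Submodule R M, N ≠ ⊥ → ∃ f : M →ₗ[R] M, LinearMap.range f ≤ N ∧ f ≠ 0

/-- Powers of a fully invariant submodule: `J^0 = ⊥`, `J^1 = J`, `J^(m+1) = J ·_M J^m`. -/
def fipow (J : Submodule R M) : ℕ → Submodule R M
  | 0 => ⊥
  | 1 => J
  | n + 2 => prodM R M J (fipow J (n + 1))

end Defs

section RingDefs

variable (S : Type*) [Ring S]

/-- A ring is semiprime: no nonzero two-sided ideal squares to zero. -/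
def IsSemiprimeRing : Prop :=
  ∀ I : TwoSidedIdeal S, (∀ a ∈ I, ∀ b ∈ I, a * b = 0) → I = ⊥

/-- A ring is prime: `I · J = 0` forces `I = 0` or `J = 0` for two-sided ideals. -/
def IsPrimeRing : Prop :=
  ∀ I J : TwoSidedIdeal S, (∀ a ∈ I, ∀ b ∈ J, a * b = 0) → I = ⊥ ∨ J = ⊥

/-- A right annihilator subset of `S`: `{ s | X s = 0 }` for some `X ⊆ S`. -/
def IsRightAnnihilatorSet (T : Set S) : Prop :=
  ∃ X : Set S, T = {s : S | ∀ x ∈ X, x * s = 0}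

/-- ACC on right annihilators of the ring `S`. -/
def AccRightAnnihilators : Prop :=
  ∀ a : ℕ → Set S, (∀ n, IsRightAnnihilatorSet S (a n)) → (∀ n, a n ⊆ a (n + 1)) →
    ∃ n, ∀ m, n ≤ m → a m = a n

/-- `S` is a right Goldie ring: ACC on right annihilators and finite uniform dimension
as a right `S`-module. -/
def IsRightGoldieRing : Prop :=
  AccRightAnnihilators S ∧ HasFinUdim Sᵐᵒᵖ S

end RingDefs

section Helpers

variable {R : Type u} [Ring R] {M : Type v} [AddCommGroup M] [Module R M]

theorem inSigmaM_finsupp (ι : Type v) (K : Submodule R M) : InSigmaM R M (ι →₀ K) :=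
  ⟨ι →₀ M, inferInstance, inferInstance, ⟨ι, LinearMap.id, Function.surjective_id⟩,
    Finsupp.mapRange.linearMap K.subtype,
    Finsupp.mapRange_injective _ (map_zero _) K.injective_subtype⟩

theorem inSigmaM_submodule (K : Submodule R M) : InSigmaM R M K :=
  ⟨M, inferInstance, inferInstance,
    ⟨PUnit, Finsupp.lsum ℕ fun _ => LinearMap.id,
      fun x => ⟨Finsupp.single PUnit.unit x, by simp⟩⟩,
    K.subtype, K.injective_subtype⟩

theorem mem_annM {N : Submodule R M} {x : M} :
    x ∈ annM R M N ↔ ∀ f : M →ₗ[R] M, LinearMap.range f ≤ N → f x = 0 := by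
  simp [annM, Submodule.mem_iInf]

theorem isFullyInvariant_annM (N : Submodule R M) : IsFullyInvariant R M (annM R M N) := by
  rintro g _ ⟨x, hx, rfl⟩
  exact mem_annM.2 fun f hf =>
    mem_annM.1 hx (f ∘ₗ g) ((LinearMap.range_comp_le_range g f).trans hf)

theorem le_annM_of_inf_eq_bot {L N : Submodule R M} (hL : IsFullyInvariant R M L)
    (h : L ⊓ N = ⊥) : L ≤ annM R M N := fun x hx => mem_annM.2 fun f hf => by
  have : f x ∈ L ⊓ N := ⟨hL f ⟨x, hx, rfl⟩, hf ⟨x, rfl⟩⟩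
  simpa [h] using this

/-- The sum map `K^(End M) → M`, `(k_g) ↦ ∑ g k_g`, whose range is the smallest fully invariant
submodule containing `K`. -/
noncomputable def endSum (K : Submodule R M) : ((M →ₗ[R] M) →₀ K) →ₗ[R] M :=
  Finsupp.lsum ℕ fun g => g ∘ₗ K.subtype

theorem endSum_apply (K : Submodule R M) (c : (M →ₗ[R] M) →₀ K) :
    endSum K c = c.sum fun g k => g k := rfl

theorem le_range_endSum (K : Submodule R M) : K ≤ LinearMap.range (endSum K) :=
  fun x hx => ⟨Finsupp.single LinearMap.id ⟨x, hx⟩, by simp [endSum]⟩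

theorem range_endSum_le {K L : Submodule R M} (hL : IsFullyInvariant R M L) (h : K ≤ L) :
    LinearMap.range (endSum K) ≤ L := by
  rintro _ ⟨c, rfl⟩
  rw [endSum_apply]
  exact Submodule.sum_mem _ fun g _ => hL g ⟨_, h (c g).2, rfl⟩

theorem isFullyInvariant_range_endSum (K : Submodule R M) :
    IsFullyInvariant R M (LinearMap.range (endSum K)) := by
  rintro f _ ⟨_, ⟨c, rfl⟩, rfl⟩
  rw [endSum_apply, Finsupp.sum, map_sum]
  exact Submodule.sum_mem _ fun g _ => ⟨Finsupp.single (f ∘ₗ g) (c g), by simp [endSum]⟩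

theorem annM_le_annM_range_endSum (hproj : ProjectiveInSigmaM R M) (K : Submodule R M) :
    annM R M K ≤ annM R M (LinearMap.range (endSum K)) := fun x hx => mem_annM.2 fun f hf => by
  obtain ⟨h, hh⟩ := hproj _ _ (inSigmaM_finsupp _ K) (inSigmaM_submodule _)
    (endSum K).rangeRestrict (endSum K).surjective_rangeRestrict
    (f.codRestrict _ fun y => hf ⟨y, rfl⟩)
  have hfx : endSum K (h x) = f x := congrArg Subtype.val (LinearMap.congr_fun hh x)
  have h_zero : h x = 0 := by
    ext g
    refine mem_annM.1 hx (K.subtype ∘ₗ Finsupp.lapply g ∘ₗ h) ?_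
    rintro _ ⟨y, rfl⟩
    exact (h y g).2
  rw [← hfx, h_zero, map_zero]

theorem annM_anti {K N : Submodule R M} (h : K ≤ N) : annM R M N ≤ annM R M K :=
  fun _ hx => mem_annM.2 fun f hf => mem_annM.1 hx f (hf.trans h)

theorem annM_inf_self_eq_bot (hproj : ProjectiveInSigmaM R M) (hsemi : IsSemiprimeModule R M)
    (N : Submodule R M) : annM R M N ⊓ N = ⊥ := by
  set K := annM R M N ⊓ N
  have hK : LinearMap.range (endSum K) ≤ annM R M (LinearMap.range (endSum K)) :=
    ((range_endSum_le (isFullyInvariant_annM N) inf_le_left).trans (annM_anti inf_le_right)).trans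
      (annM_le_annM_range_endSum hproj K)
  refine le_bot_iff.1 ((le_range_endSum K).trans
    (hsemi.2 _ (isFullyInvariant_range_endSum K) (iSup₂_le fun f hf => ?_)))
  rintro _ ⟨x, hx, rfl⟩
  exact mem_annM.1 (hK hx) f hf

end Helpers

/-- For `M` projective in `σ[M]` and semiprime and `N ≤ M`:
(1) `Ann_M(N) ⊓ N = 0`; (2) every fully invariant `L` with `L ⊓ N = 0` lies in
`Ann_M(N)`; (3) `N + Ann_M(N)` meets every nonzero fully invariant submodule. -/
theorem stmt14 (R : Type u) [Ring R] (M : Type v) [AddCommGroup M] [Module R M]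
    (hproj : ProjectiveInSigmaM R M) (hsemi : IsSemiprimeModule R M)
    (N : Submodule R M) :
    annM R M N ⊓ N = ⊥ ∧
    (∀ L : Submodule R M, IsFullyInvariant R M L → L ⊓ N = ⊥ → L ≤ annM R M N) ∧
    (∀ L : Submodule R M, IsFullyInvariant R M L → L ≠ ⊥ →
      (N ⊔ annM R M N) ⊓ L ≠ ⊥) := by
  refine ⟨annM_inf_self_eq_bot hproj hsemi N, fun L hL h => le_annM_of_inf_eq_bot hL h,
    fun L hL hne h => hne ?_⟩
  have hLN : L ⊓ N = ⊥ := le_bot_iff.1 (h ▸ le_inf (inf_le_right.trans le_sup_left) inf_le_left)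
  exact le_bot_iff.1 (h ▸ le_inf ((le_annM_of_inf_eq_bot hL hLN).trans le_sup_right) le_rfl)
end

section
/- Let R be an associative unital ring, M a left R-module that is projective in σ[M], and N a fully invariant submodule of M. The following are equivalent: (a) N is semiprime in M; (b) every submodule K ≤ M (not necessarily fully invariant) with K·_M K ≤ N satisfies K ≤ N; (c) every submodule K ≤ M with N ≤ K and K·_M K ≤ N satisfies K = N. -/
universe u v

theorem prodM_le_iff {R : Type u} [Ring R] {M : Type v} [AddCommGroup M] [Module R M]
    {K L N : Submodule R M} :
    prodM R M K L ≤ N ↔ ∀ f : M →ₗ[R] M, LinearMap.range f ≤ L → ∀ x ∈ K, f x ∈ N := by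
  simp only [prodM, iSup_le_iff, Submodule.map_le_iff_le_comap]
  rfl

theorem isFullyInvariant_prodM_top {R : Type u} [Ring R] {M : Type v} [AddCommGroup M]
    [Module R M] (K : Submodule R M) : IsFullyInvariant R M (prodM R M K ⊤) := by
  intro f
  rw [Submodule.map_le_iff_le_comap, prodM_le_iff]
  intro g _ x hx
  exact prodM_le_iff.1 le_rfl (f ∘ₗ g) le_top x hx

theorem le_prodM_top {R : Type u} [Ring R] {M : Type v} [AddCommGroup M]
    [Module R M] (K : Submodule R M) : K ≤ prodM R M K ⊤ := fun x hx =>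
  prodM_le_iff.1 le_rfl LinearMap.id le_top x hx

theorem inSigmaM_submodule_finsupp {R : Type u} [Ring R] {M : Type v} [AddCommGroup M]
    [Module R M] {ι : Type v} (S : Submodule R (ι →₀ M)) : InSigmaM R M S :=
  ⟨ι →₀ M, inferInstance, inferInstance, ⟨ι, LinearMap.id, Function.surjective_id⟩,
    S.subtype, S.injective_subtype⟩

theorem inSigmaM_submodule_s15 {R : Type u} [Ring R] {M : Type v} [AddCommGroup M]
    [Module R M] (S : Submodule R M) : InSigmaM R M S :=
  ⟨M, inferInstance, inferInstance,
    ⟨PUnit, Finsupp.lapply PUnit.unit, fun x => ⟨Finsupp.single PUnit.unit x, by simp⟩⟩,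
    S.subtype, S.injective_subtype⟩

/-- An endomorphism of `M` with range in `∑ i, g i (p i)` lifts to a locally finite family of
homomorphisms `M → p i`, so its values can be controlled through the homomorphisms `M → p i`. -/
theorem ProjectiveInSigmaM.apply_mem_of_range_le_iSup {R : Type u} [Ring R] {M : Type v}
    [AddCommGroup M] [Module R M] (hproj : ProjectiveInSigmaM R M) {ι : Type v}
    (g : ι → M →ₗ[R] M) (p : ι → Submodule R M) (P : Submodule R M) (h : M →ₗ[R] M)
    (hh : LinearMap.range h ≤ ⨆ i, (p i).map (g i)) (x : M)
    (hx : ∀ (i : ι) (f : M →ₗ[R] M), LinearMap.range f ≤ p i → g i (f x) ∈ P) : h x ∈ P := by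
  classical
  let S : Submodule R (ι →₀ M) := ⨅ i, (p i).comap (Finsupp.lapply i)
  let φ : (ι →₀ M) →ₗ[R] M := Finsupp.lsum ℕ g
  have hS : ⨆ i, (p i).map (g i) ≤ S.map φ := by
    refine iSup_le fun i => ?_
    rintro _ ⟨y, hy, rfl⟩
    refine ⟨Finsupp.single i y, ?_, by simp [φ]⟩
    refine Submodule.mem_iInf _ |>.2 fun j => ?_
    by_cases hij : i = j
    · subst hij
      simpa using hy
    · simp [hij]
  obtain ⟨f, hf⟩ := hproj S (S.map φ) (inSigmaM_submodule_finsupp S) (inSigmaM_submodule_s15 _)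
    (φ.submoduleMap S) (φ.submoduleMap_surjective S)
    (h.codRestrict (S.map φ) fun y => hS (hh ⟨y, rfl⟩))
  have hfx : φ (f x : ι →₀ M) = h x := congrArg Subtype.val (LinearMap.congr_fun hf x)
  rw [← hfx, Finsupp.lsum_apply]
  refine Submodule.sum_mem _ fun i _ => hx i (Finsupp.lapply i ∘ₗ S.subtype ∘ₗ f) ?_
  rintro _ ⟨y, rfl⟩
  exact (Submodule.mem_iInf _).1 (f y).2 i

theorem ProjectiveInSigmaM.prodM_prodM_top_le {R : Type u} [Ring R] {M : Type v}
    [AddCommGroup M] [Module R M] (hproj : ProjectiveInSigmaM R M) {K N : Submodule R M}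
    (hN : IsFullyInvariant R M N) (hK : prodM R M K K ≤ N) :
    prodM R M (prodM R M K ⊤) (prodM R M K ⊤) ≤ N := by
  rw [prodM_le_iff]
  intro f hf
  suffices prodM R M K ⊤ ≤ N.comap f from this
  rw [prodM_le_iff]
  intro g _ x hx
  refine hproj.apply_mem_of_range_le_iSup (fun e : M →ₗ[R] M => e) (fun _ => K) N (f ∘ₗ g)
    ?_ x fun e l hl => hN e ⟨l x, prodM_le_iff.1 hK l hl x hx, rfl⟩
  refine (LinearMap.range_comp_le_range g f).trans (hf.trans ?_)
  exact iSup_mono fun e => iSup_le fun _ => le_rfl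

theorem ProjectiveInSigmaM.prodM_sup_le {R : Type u} [Ring R] {M : Type v}
    [AddCommGroup M] [Module R M] (hproj : ProjectiveInSigmaM R M) {K N : Submodule R M}
    (hN : IsFullyInvariant R M N) (hK : prodM R M K K ≤ N) :
    prodM R M (K ⊔ N) (K ⊔ N) ≤ N := by
  rw [prodM_le_iff]
  intro f hf
  suffices K ⊔ N ≤ N.comap f from this
  refine sup_le (fun x hx => ?_) (Submodule.map_le_iff_le_comap.1 (hN f))
  refine hproj.apply_mem_of_range_le_iSup (fun _ : ULift Bool => LinearMap.id)
    (fun b => if b.down then K else N) N f (hf.trans (sup_le ?_ ?_)) x ?_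
  · exact le_iSup_of_le ⟨true⟩ (by simp)
  · exact le_iSup_of_le ⟨false⟩ (by simp)
  · rintro ⟨_ | _⟩ l hl
    · exact hl ⟨x, rfl⟩
    · exact prodM_le_iff.1 hK l hl x hx

/-- For `M` projective in `σ[M]` and `N` fully invariant: `N` semiprime
iff every submodule `K` with `K·_M K ≤ N` satisfies `K ≤ N` iff every `K ⊇ N` with
`K·_M K ≤ N` equals `N`. -/
theorem stmt15 (R : Type u) [Ring R] (M : Type v) [AddCommGroup M] [Module R M]
    (hproj : ProjectiveInSigmaM R M) (N : Submodule R M)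
    (hNfi : IsFullyInvariant R M N) :
    (IsSemiprimeSubmodule R M N ↔
      ∀ K : Submodule R M, prodM R M K K ≤ N → K ≤ N) ∧
    (IsSemiprimeSubmodule R M N ↔
      ∀ K : Submodule R M, N ≤ K → prodM R M K K ≤ N → K = N) := by
  have hb : IsSemiprimeSubmodule R M N → ∀ K : Submodule R M, prodM R M K K ≤ N → K ≤ N :=
    fun h K hK => (le_prodM_top K).trans
      (h.2 _ (isFullyInvariant_prodM_top K) (hproj.prodM_prodM_top_le hNfi hK))
  refine ⟨⟨hb, fun h => ⟨hNfi, fun K _ hK => h K hK⟩⟩,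
    fun h K hNK hK => le_antisymm (hb h K hK) hNK, fun h => ⟨hNfi, fun K _ hK => ?_⟩⟩
  exact sup_eq_right.1 (h (K ⊔ N) le_sup_right (hproj.prodM_sup_le hNfi hK))
end
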